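/- Let G be a group, H ≤ G a subgroup of finite index (H.index ≠ 0), σ : Fin k → G with Subgroup.closure (Set.range σ) = ⊤, and τ : Fin l → H with Subgroup.closure (Set.range τ) = ⊤. Then the recurring domino problem RDP(G,σ) is ComputablePred if and only if RDP(H,τ) is ComputablePred. -/

import Mathlib

/-- An instance of the domino problems on a group with a generating family
indexed by `Fin k`. -/
abbrev DomInstance (k : ℕ) : Type := Σ m : ℕ, Finset (Fin m × Fin m × Fin k) × Fin m

instance (k : ℕ) : Infinite (DomInstance k) :=
  Infinite.of_injective (fun n => (⟨n + 1, ∅, 0⟩ : DomInstance k)) fun a b h => by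
    have : a + 1 = b + 1 := congrArg Sigma.fst h
    omega

noncomputable instance (k : ℕ) : Denumerable (DomInstance k) :=
  Denumerable.ofEncodableOfInfinite _

/-- The recurring domino problem on `G` with respect to the generating family `σ`. -/
def RDP (G : Type*) [Group G] {k : ℕ} (σ : Fin k → G) (I : DomInstance k) : Prop :=
  ∃ x : G → Fin I.1,
    (∀ (g : G) (i : Fin k), (x g, x (g * σ i), i) ∉ I.2.1) ∧
    {g : G | x g = I.2.2}.Infinite

open Encodable

theorem Finset.exists_sorted_list_encode {α : Type*} [Encodable α] (s : Finset α) :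
    ∃ l : List α, encode s = encode l ∧ (∀ a, a ∈ l ↔ a ∈ s) ∧ l.Pairwise (fun a b => encode a < encode b) := by
  have h : ∃ l : List α, encode s = encode l ∧ (l : Multiset α) = s.val ∧
      l.Pairwise (fun a b => encode a ≤ encode b) := by
    let _ : LinearOrder α := LinearOrder.lift' encode encode_injective
    refine ⟨s.val.sort (· ≤ ·), ?_, Multiset.sort_eq _ _, Multiset.pairwise_sort _ _⟩
    change encodeMultiset s.val = _
    unfold encodeMultiset
    congr!
  obtain ⟨l, h1, h2, h3⟩ := h
  refine ⟨l, h1, fun a => by rw [← Finset.mem_val, ← h2, Multiset.mem_coe], ?_⟩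
  have hn : l.Nodup := by rw [← Multiset.coe_nodup, h2]; exact s.nodup
  exact List.Pairwise.imp₂ (fun a b hab hne => lt_of_le_of_ne hab fun h => hne (encode_injective h)) h3 hn

open Classical in
theorem Denumerable.encode_ofEncodableOfInfinite {α : Type*} [Encodable α] [Infinite α] (a : α) :
    @encode α (Denumerable.ofEncodableOfInfinite α).toEncodable a =
      ((List.range (encode a)).filter (· ∈ Set.range (encode : α → ℕ))).length := by
  rw [← List.countP_eq_length_filter]
  have : @encode α (Denumerable.ofEncodableOfInfinite α).toEncodable a =
      @List.countP ℕ (fun x => @decide (x ∈ Set.range (encode : α → ℕ))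
        (decidableRangeEncode α x)) (List.range (encode a)) := rfl
  rw [this]
  congr!

theorem Encodable.encode_map_encode {α : Type*} [Encodable α] (l : List α) :
    encode (l.map encode) = encode l := by
  induction l with
  | nil => rfl
  | cons a l ih => simp [ih]

/-- The code of a finset is the code of the increasing list of the codes of its elements. -/
theorem Finset.encode_eq_encode_list {α : Type*} [Encodable α] (s : Finset α) (L : List ℕ)
    (hL : L.Pairwise (· < ·)) (h : ∀ t, t ∈ L ↔ ∃ a ∈ s, encode a = t) : encode s = encode L := by
  obtain ⟨l, h1, h2, h3⟩ := s.exists_sorted_list_encode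
  rw [h1, ← Encodable.encode_map_encode]
  congr 1
  refine List.Pairwise.eq_of_mem_iff (r := (· < ·)) ?_ hL fun t => ?_
  · rwa [List.pairwise_map]
  · simp [h, h2]

theorem primrecRel_mem_list : PrimrecRel fun (t : ℕ) (L : List ℕ) => t ∈ L :=
  ((PrimrecRel.exists_mem_list (Primrec.eq (α := ℕ))).swap).of_eq fun t L => by
    simp [Function.swap]

theorem Nat.pair_mono {a b c d : ℕ} (h1 : a ≤ c) (h2 : b ≤ d) : Nat.pair a b ≤ Nat.pair c d := by
  rcases h1.lt_or_eq with h1 | rfl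
  · rcases h2.lt_or_eq with h2 | rfl
    · exact ((Nat.pair_lt_pair_left _ h1).trans (Nat.pair_lt_pair_right _ h2)).le
    · exact (Nat.pair_lt_pair_left _ h1).le
  · rcases h2.lt_or_eq with h2 | rfl
    · exact (Nat.pair_lt_pair_right _ h2).le
    · exact le_rfl

/-- The recurring domino problem with the forbidden patterns given by a list of codes. -/
def RawRDP (G : Type*) [Group G] {k : ℕ} (σ : Fin k → G) (r : ℕ × List ℕ × ℕ) : Prop :=
  ∃ x : G → ℕ, (∀ g, x g < r.1) ∧
    (∀ (g : G) (i : Fin k), Nat.pair (x g) (Nat.pair (x (g * σ i)) i) ∉ r.2.1) ∧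
    {g : G | x g = r.2.2}.Infinite

namespace DomInstance

/-- `t` codes a nearest-neighbour pattern over the alphabet `Fin m` with `k` directions. -/
def IsPattern (k m t : ℕ) : Prop :=
  t.unpair.1 < m ∧ t.unpair.2.unpair.1 < m ∧ t.unpair.2.unpair.2 < k

instance (k m t : ℕ) : Decidable (IsPattern k m t) :=
  inferInstanceAs (Decidable (_ ∧ _ ∧ _))

/-- The increasing list of the codes of the forbidden patterns of a raw instance. -/
def patternList (k : ℕ) (r : ℕ × List ℕ × ℕ) : List ℕ :=
  (List.range (Nat.pair r.1 (Nat.pair r.1 k))).filter fun t => t ∈ r.2.1 ∧ IsPattern k r.1 t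

theorem mem_patternList {k : ℕ} {r : ℕ × List ℕ × ℕ} {t : ℕ} :
    t ∈ patternList k r ↔ t ∈ r.2.1 ∧ IsPattern k r.1 t := by
  simp only [patternList, List.mem_filter, List.mem_range, decide_eq_true_eq, and_iff_right_iff_imp]
  rintro ⟨-, h1, h2, h3⟩
  rw [← Nat.pair_unpair t]
  refine (Nat.pair_lt_pair_left _ h1).trans_le (Nat.pair_mono le_rfl ?_)
  rw [← Nat.pair_unpair t.unpair.2]
  exact Nat.pair_mono h2.le h3.le

theorem primrec_patternList (k : ℕ) : Primrec (patternList k) := by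
  have hu1 : Primrec fun p : ℕ × ℕ × List ℕ × ℕ => p.1.unpair.1 :=
    Primrec.fst.comp (Primrec.unpair.comp Primrec.fst)
  have hu2 : Primrec fun p : ℕ × ℕ × List ℕ × ℕ => p.1.unpair.2.unpair :=
    Primrec.unpair.comp (Primrec.snd.comp (Primrec.unpair.comp Primrec.fst))
  have hm : Primrec fun p : ℕ × ℕ × List ℕ × ℕ => p.2.1 := Primrec.fst.comp Primrec.snd
  have hR : PrimrecRel fun (t : ℕ) (r : ℕ × List ℕ × ℕ) => t ∈ r.2.1 ∧ IsPattern k r.1 t :=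
    PrimrecPred.and
      (primrecRel_mem_list.comp Primrec.fst (Primrec.fst.comp (Primrec.snd.comp Primrec.snd)))
      (PrimrecPred.and (Primrec.nat_lt.comp hu1 hm)
        (PrimrecPred.and (Primrec.nat_lt.comp (Primrec.fst.comp hu2) hm)
          (Primrec.nat_lt.comp (Primrec.snd.comp hu2) (Primrec.const k))))
  exact hR.listFilter.comp (Primrec.list_range.comp (Primrec₂.natPair.comp Primrec.fst
    (Primrec₂.natPair.comp Primrec.fst (Primrec.const k)))) Primrec.id

/-- The code of an instance under the structural (non-surjective) encoding. -/
def rawCode {k : ℕ} (I : DomInstance k) : ℕ :=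
  Nat.pair I.1 (Nat.pair (encode I.2.1) I.2.2)

/-- The instance described by a raw instance. -/
def ofRaw (k : ℕ) (r : ℕ × List ℕ × ℕ) : DomInstance k :=
  if h : r.2.2 < r.1 then
    ⟨r.1, Finset.univ.filter fun p => encode p ∈ r.2.1, ⟨r.2.2, h⟩⟩
  else ⟨1, ∅, 0⟩

/-- The raw instance with a given code. -/
def decodeRaw (n : ℕ) : ℕ × List ℕ × ℕ :=
  (n.unpair.1, Denumerable.ofNat (List ℕ) n.unpair.2.unpair.1, n.unpair.2.unpair.2)

theorem primrec_decodeRaw : Primrec decodeRaw := by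
  have h : Primrec fun n : ℕ => n.unpair.2.unpair :=
    Primrec.unpair.comp (Primrec.snd.comp Primrec.unpair)
  exact (Primrec.fst.comp Primrec.unpair).pair
    (((Primrec.ofNat _).comp (Primrec.fst.comp h)).pair (Primrec.snd.comp h))

theorem encode_pattern {m k : ℕ} (p : Fin m × Fin m × Fin k) :
    encode p = Nat.pair p.1 (Nat.pair p.2.1 p.2.2) := rfl

theorem isPattern_iff {k m t : ℕ} :
    IsPattern k m t ↔ ∃ p : Fin m × Fin m × Fin k, encode p = t := by
  constructor
  · rintro ⟨h1, h2, h3⟩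
    exact ⟨(⟨_, h1⟩, ⟨_, h2⟩, ⟨_, h3⟩), by
      change Nat.pair t.unpair.1 (Nat.pair t.unpair.2.unpair.1 t.unpair.2.unpair.2) = t
      rw [Nat.pair_unpair, Nat.pair_unpair]⟩
  · rintro ⟨p, rfl⟩
    simp [IsPattern, encode_pattern]

theorem rawCode_ofRaw {k : ℕ} (r : ℕ × List ℕ × ℕ) :
    rawCode (ofRaw k r) = if r.2.2 < r.1 then
      Nat.pair r.1 (Nat.pair (encode (patternList k r)) r.2.2) else Nat.pair 1 (Nat.pair 0 0) := by
  unfold ofRaw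
  split_ifs with h
  · simp only [rawCode]
    congr 2
    refine Finset.encode_eq_encode_list _ _ (List.pairwise_lt_range.filter _) fun t => ?_
    simp only [mem_patternList, isPattern_iff, Finset.mem_filter, Finset.mem_univ, true_and]
    constructor
    · rintro ⟨h1, p, rfl⟩
      exact ⟨p, h1, rfl⟩
    · rintro ⟨p, h1, rfl⟩
      exact ⟨h1, p, rfl⟩
  · simp only [rawCode]
    congr 2
    exact Finset.encode_eq_encode_list _ [] List.Pairwise.nil (by simp)

theorem decodeRaw_rawCode {k : ℕ} (I : DomInstance k) :
    ∃ L : List ℕ, decodeRaw (rawCode I) = (I.1, L, (I.2.2 : ℕ)) ∧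
      ∀ p, encode p ∈ L ↔ p ∈ I.2.1 := by
  obtain ⟨l, h1, h2, -⟩ := I.2.1.exists_sorted_list_encode
  refine ⟨l.map encode, ?_, fun p => ?_⟩
  · simp [decodeRaw, rawCode, h1, ← Encodable.encode_map_encode l]
  · rw [List.mem_map_of_injective encode_injective, h2]

theorem ofRaw_decodeRaw_rawCode {k : ℕ} (I : DomInstance k) :
    ofRaw k (decodeRaw (rawCode I)) = I := by
  obtain ⟨L, h, hL⟩ := decodeRaw_rawCode I
  obtain ⟨m, F, a⟩ := I
  rw [h, ofRaw, dif_pos a.2]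
  simp [hL]

theorem primrec_rawCode_ofRaw (k : ℕ) : Primrec fun r => rawCode (ofRaw k r) := by
  have ha : Primrec fun r : ℕ × List ℕ × ℕ => r.2.2 := Primrec.snd.comp Primrec.snd
  exact (Primrec.ite (Primrec.nat_lt.comp ha Primrec.fst)
    (Primrec₂.natPair.comp Primrec.fst
      (Primrec₂.natPair.comp (Primrec.encode.comp (primrec_patternList k)) ha))
    (Primrec.const _)).of_eq fun r => (rawCode_ofRaw r).symm

theorem primrecPred_mem_range_rawCode (k : ℕ) :
    PrimrecPred fun n => n ∈ Set.range (rawCode (k := k)) :=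
  (Primrec.eq.comp ((primrec_rawCode_ofRaw k).comp primrec_decodeRaw) Primrec.id).of_eq fun n =>
    ⟨fun h => ⟨_, h⟩, by rintro ⟨I, rfl⟩; simp [ofRaw_decodeRaw_rawCode]⟩

open Classical in
/-- The position of a number among the codes of instances. -/
noncomputable def rank (k n : ℕ) : ℕ :=
  ((List.range n).filter (· ∈ Set.range (rawCode (k := k)))).length

theorem encode_eq_rank {k : ℕ} (I : DomInstance k) :
    @encode _ Primcodable.toEncodable I = rank k (rawCode I) :=
  Denumerable.encode_ofEncodableOfInfinite I

theorem primrec_rank (k : ℕ) : Primrec (rank k) := by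
  classical
  exact Primrec.list_length.comp
    ((Primrec.listFilter (primrecPred_mem_range_rawCode k)).comp Primrec.list_range)

theorem primrec_ofRaw (k : ℕ) : Primrec (ofRaw k) :=
  Primrec.encode_iff.1 <| ((primrec_rank k).comp (primrec_rawCode_ofRaw k)).of_eq fun _ =>
    (encode_eq_rank _).symm

theorem computable_rawCode (k : ℕ) : Computable (rawCode (k := k)) := by
  classical
  let P : DomInstance k → ℕ → Prop := fun I c =>
    c ∈ Set.range (rawCode (k := k)) ∧ rank k c = @encode _ Primcodable.toEncodable I
  have hP : ComputablePred fun p : DomInstance k × ℕ => P p.1 p.2 :=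
    (((primrecPred_mem_range_rawCode k).comp Primrec.snd).and
      (Primrec.eq.comp ((primrec_rank k).comp Primrec.snd)
        (Primrec.encode.comp Primrec.fst))).computablePred
  have hex : ∀ I, ∃ c, P I c := fun I => ⟨rawCode I, ⟨I, rfl⟩, (encode_eq_rank I).symm⟩
  refine (Computable.find hP hex).of_eq fun I => ?_
  obtain ⟨⟨J, hJ⟩, h⟩ := Nat.find_spec (hex I)
  rw [← hJ] at h ⊢
  rw [← encode_eq_rank] at h
  rw [@encode_injective _ Primcodable.toEncodable _ _ h]

end DomInstance

open DomInstance in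
theorem rdp_ofRaw_iff {G : Type*} [Group G] {k : ℕ} (σ : Fin k → G) {r : ℕ × List ℕ × ℕ}
    (hr : r.2.2 < r.1) : RDP G σ (ofRaw k r) ↔ RawRDP G σ r := by
  rw [ofRaw, dif_pos hr]
  constructor
  · rintro ⟨x, h1, h2⟩
    refine ⟨fun g => x g, fun g => (x g).2, fun g i => ?_, ?_⟩
    · exact fun h => h1 g i (Finset.mem_filter.2 ⟨Finset.mem_univ _, h⟩)
    · simpa [Fin.ext_iff] using h2
  · rintro ⟨x, h0, h1, h2⟩
    refine ⟨fun g => ⟨x g, h0 g⟩, fun g i => ?_, ?_⟩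
    · exact fun h => h1 g i (Finset.mem_filter.1 h).2
    · simpa [Fin.ext_iff] using h2

open DomInstance in
theorem computablePred_rdp_iff_raw {G : Type*} [Group G] {k : ℕ} (σ : Fin k → G) :
    ComputablePred (RDP G σ) ↔ ComputablePred (RawRDP G σ) := by
  constructor
  · intro h
    obtain ⟨f, hf, hfe⟩ := ComputablePred.computable_iff.1 h
    have hlt : PrimrecPred fun r : ℕ × List ℕ × ℕ => r.2.2 < r.1 :=
      Primrec.nat_lt.comp (Primrec.snd.comp Primrec.snd) Primrec.fst
    refine ComputablePred.computable_iff.2 ⟨fun r => decide (r.2.2 < r.1) && f (ofRaw k r),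
      Primrec.and.to_comp.comp hlt.decide.to_comp (hf.comp (primrec_ofRaw k).to_comp), ?_⟩
    ext r
    by_cases hr : r.2.2 < r.1
    · rw [← rdp_ofRaw_iff σ hr, hfe]
      simp [hr]
    · simp only [hr, decide_false, Bool.false_and, Bool.false_eq_true, iff_false]
      rintro ⟨x, h0, -, h2⟩
      obtain ⟨g, hg⟩ := h2.nonempty
      exact hr (hg ▸ h0 g)
  · intro h
    refine ComputablePred.computable_of_manyOneReducible
      ⟨fun I => decodeRaw (rawCode I), primrec_decodeRaw.to_comp.comp (computable_rawCode k),
        fun I => ?_⟩ h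
    obtain ⟨L, hI, -⟩ := decodeRaw_rawCode I
    rw [← rdp_ofRaw_iff, ofRaw_decodeRaw_rawCode]
    simp [hI]

theorem ComputablePred.exists_lt {α : Type*} [Primcodable α] {p : α → ℕ → Prop} {B : α → ℕ}
    (hp : ComputablePred fun x : α × ℕ => p x.1 x.2) (hB : Computable B) :
    ComputablePred fun a => ∃ s < B a, p a s := by
  obtain ⟨f, hf, hfe⟩ := ComputablePred.computable_iff.1 hp
  have hpf : ∀ a s, p a s ↔ f (a, s) = true := fun a s => by simpa using congrFun hfe (a, s)
  refine ComputablePred.computable_iff.2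
    ⟨fun a => Nat.rec (motive := fun _ => Bool) false (fun s b => b || f (a, s)) (B a), ?_, ?_⟩
  · have h : Computable₂ fun (a : α) (x : ℕ × Bool) => x.2 || f (a, x.1) :=
      Primrec.or.to_comp.comp (Computable.snd.comp Computable.snd)
        (hf.comp (Computable.fst.pair (Computable.fst.comp Computable.snd)))
    exact Computable.nat_rec hB (Computable.const false) h
  · ext a
    simp only [hpf]
    induction B a with
    | zero => simp
    | succ n ih =>
      rw [Bool.or_eq_true, ← ih]
      constructor
      · rintro ⟨s, hs, h⟩
        rcases Nat.lt_succ_iff_lt_or_eq.1 hs with hs | rfl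
        exacts [Or.inl ⟨s, hs, h⟩, Or.inr h]
      · rintro (⟨s, hs, h⟩ | h)
        exacts [⟨s, hs.trans n.lt_succ_self, h⟩, ⟨n, n.lt_succ_self, h⟩]

/-- The `p`-th digit of `u` in base `m`. -/
def baseDigit (m u p : ℕ) : ℕ := u / m ^ p % m

theorem exists_baseDigit_eq {m N : ℕ} (f : ℕ → ℕ) (hf : ∀ p < N, f p < m) :
    ∃ u < m ^ N, ∀ p < N, baseDigit m u p = f p := by
  let F : Fin N → Fin m := fun p => ⟨f p, hf p p.2⟩
  refine ⟨finFunctionFinEquiv F, (finFunctionFinEquiv F).2, fun p hp => ?_⟩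
  have h := congrArg Fin.val (congrFun (finFunctionFinEquiv.symm_apply_apply F) ⟨p, hp⟩)
  rwa [finFunctionFinEquiv_symm_apply_val] at h

theorem baseDigit_lt {m N u p : ℕ} (hu : u < m ^ N) (hp : p < N) : baseDigit m u p < m := by
  refine Nat.mod_lt _ (Nat.pos_of_ne_zero ?_)
  rintro rfl
  rw [zero_pow (by omega)] at hu
  omega

theorem primrec_pow : Primrec₂ ((· ^ ·) : ℕ → ℕ → ℕ) :=
  Primrec₂.unpaired'.1 Nat.Primrec.pow

theorem Primrec.baseDigit {α : Type*} [Primcodable α] {f g h : α → ℕ} (hf : Primrec f)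
    (hg : Primrec g) (hh : Primrec h) : Primrec fun a => baseDigit (f a) (g a) (h a) :=
  Primrec.nat_mod.comp (Primrec.nat_div.comp hg (primrec_pow.comp hf hh)) hf

/-- Configurations of blocks of `N` symbols on `H`, where `E` prescribes equalities between
coordinates of neighbouring blocks, `C` lists the pairs of coordinates of a block to which the
forbidden patterns apply, and the letter has to recur at the coordinates in `O`. -/
def BlockRDP {H : Type*} [Group H] {l : ℕ} (τ : Fin l → H) (N : ℕ) (E C : List (ℕ × ℕ × ℕ))
    (O : List ℕ) (r : ℕ × List ℕ × ℕ) : Prop :=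
  ∃ y : H → ℕ → ℕ, (∀ h, ∀ p < N, y h p < r.1) ∧
    (∀ h i, ∀ c ∈ E, c.2.2 = ((i : Fin l) : ℕ) → y h c.1 = y (h * τ i) c.2.1) ∧
    (∀ h, ∀ c ∈ C, Nat.pair (y h c.1) (Nat.pair (y h c.2.1) c.2.2) ∉ r.2.1) ∧
    {h | ∃ p ∈ O, y h p = r.2.2}.Infinite

/-- The pattern coded by `t` is forbidden for block configurations. -/
def IsBadBlock (E C : List (ℕ × ℕ × ℕ)) (t : ℕ) (r : ℕ × List ℕ × ℕ) : Prop :=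
  (∃ c ∈ E, c.2.2 = t.unpair.2.unpair.2 ∧
    baseDigit r.1 t.unpair.1 c.1 ≠ baseDigit r.1 t.unpair.2.unpair.1 c.2.1) ∨
  ∃ c ∈ C, Nat.pair (baseDigit r.1 t.unpair.1 c.1)
    (Nat.pair (baseDigit r.1 t.unpair.1 c.2.1) c.2.2) ∈ r.2.1

theorem primrecRel_isBadBlock (E C : List (ℕ × ℕ × ℕ)) : PrimrecRel (IsBadBlock E C) := by
  have ht : Primrec fun q : (ℕ × ℕ × ℕ) × ℕ × ℕ × List ℕ × ℕ => q.2.1.unpair :=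
    Primrec.unpair.comp (Primrec.fst.comp Primrec.snd)
  have ht2 : Primrec fun q : (ℕ × ℕ × ℕ) × ℕ × ℕ × List ℕ × ℕ => q.2.1.unpair.2.unpair :=
    Primrec.unpair.comp (Primrec.snd.comp ht)
  have hr : Primrec fun q : (ℕ × ℕ × ℕ) × ℕ × ℕ × List ℕ × ℕ => q.2.2 :=
    Primrec.snd.comp Primrec.snd
  have hm : Primrec fun q : (ℕ × ℕ × ℕ) × ℕ × ℕ × List ℕ × ℕ => q.2.2.1 := Primrec.fst.comp hr
  have hc1 : Primrec fun q : (ℕ × ℕ × ℕ) × ℕ × ℕ × List ℕ × ℕ => q.1.1 :=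
    Primrec.fst.comp Primrec.fst
  have hc2 : Primrec fun q : (ℕ × ℕ × ℕ) × ℕ × ℕ × List ℕ × ℕ => q.1.2.1 :=
    Primrec.fst.comp (Primrec.snd.comp Primrec.fst)
  have hc3 : Primrec fun q : (ℕ × ℕ × ℕ) × ℕ × ℕ × List ℕ × ℕ => q.1.2.2 :=
    Primrec.snd.comp (Primrec.snd.comp Primrec.fst)
  have hE : PrimrecRel fun (c : ℕ × ℕ × ℕ) (x : ℕ × ℕ × List ℕ × ℕ) =>
      c.2.2 = x.1.unpair.2.unpair.2 ∧
        baseDigit x.2.1 x.1.unpair.1 c.1 ≠ baseDigit x.2.1 x.1.unpair.2.unpair.1 c.2.1 :=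
    PrimrecPred.and (Primrec.eq.comp hc3 (Primrec.snd.comp ht2))
      (PrimrecPred.not (Primrec.eq.comp (Primrec.baseDigit hm (Primrec.fst.comp ht) hc1)
        (Primrec.baseDigit hm (Primrec.fst.comp ht2) hc2)))
  have hC : PrimrecRel fun (c : ℕ × ℕ × ℕ) (x : ℕ × ℕ × List ℕ × ℕ) =>
      Nat.pair (baseDigit x.2.1 x.1.unpair.1 c.1)
        (Nat.pair (baseDigit x.2.1 x.1.unpair.1 c.2.1) c.2.2) ∈ x.2.2.1 :=
    primrecRel_mem_list.comp (Primrec₂.natPair.comp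
      (Primrec.baseDigit hm (Primrec.fst.comp ht) hc1)
      (Primrec₂.natPair.comp (Primrec.baseDigit hm (Primrec.fst.comp ht) hc2) hc3))
      (Primrec.fst.comp (Primrec.snd.comp hr))
  exact PrimrecPred.or (hE.exists_mem_list.comp (Primrec.const E) Primrec.id)
    (hC.exists_mem_list.comp (Primrec.const C) Primrec.id)

open Classical in
/-- The raw instance whose symbols are the blocks of `N` symbols, coded in base `r.1`, with
recurring letter the block `s`. -/
noncomputable def blockInstance (l N : ℕ) (E C : List (ℕ × ℕ × ℕ)) (r : ℕ × List ℕ × ℕ) (s : ℕ) :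
    ℕ × List ℕ × ℕ :=
  (r.1 ^ N, (List.range (Nat.pair (r.1 ^ N) (Nat.pair (r.1 ^ N) l))).filter
    fun t => IsBadBlock E C t r, s)

theorem primrec_blockInstance (l N : ℕ) (E C : List (ℕ × ℕ × ℕ)) :
    Primrec₂ (blockInstance l N E C) := by
  classical
  have hM : Primrec fun x : (ℕ × List ℕ × ℕ) × ℕ => x.1.1 ^ N :=
    primrec_pow.comp (Primrec.fst.comp Primrec.fst) (Primrec.const N)
  exact hM.pair (((primrecRel_isBadBlock E C).listFilter.comp
    (Primrec.list_range.comp (Primrec₂.natPair.comp hM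
      (Primrec₂.natPair.comp hM (Primrec.const l)))) Primrec.fst).pair Primrec.snd)

theorem pair_notMem_blockInstance_iff {l N : ℕ} {E C : List (ℕ × ℕ × ℕ)} {r : ℕ × List ℕ × ℕ}
    {s u v : ℕ} (hu : u < r.1 ^ N) (hv : v < r.1 ^ N) (i : Fin l) :
    Nat.pair u (Nat.pair v i) ∉ (blockInstance l N E C r s).2.1 ↔
      (∀ c ∈ E, c.2.2 = (i : ℕ) → baseDigit r.1 u c.1 = baseDigit r.1 v c.2.1) ∧
      ∀ c ∈ C, Nat.pair (baseDigit r.1 u c.1) (Nat.pair (baseDigit r.1 u c.2.1) c.2.2) ∉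
        r.2.1 := by
  have hlt : Nat.pair u (Nat.pair v i) < Nat.pair (r.1 ^ N) (Nat.pair (r.1 ^ N) l) :=
    (Nat.pair_lt_pair_left _ hu).trans_le
      (Nat.pair_mono le_rfl (Nat.pair_mono hv.le i.2.le))
  simp only [blockInstance, List.mem_filter, List.mem_range, hlt, true_and, decide_eq_true_eq,
    IsBadBlock, Nat.unpair_pair, not_or, not_exists, not_and, not_not]

theorem blockRDP_iff {H : Type*} [Group H] {l : ℕ} (hl : 0 < l) (τ : Fin l → H) {N : ℕ}
    {E C : List (ℕ × ℕ × ℕ)} {O : List ℕ} (hE : ∀ c ∈ E, c.1 < N ∧ c.2.1 < N)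
    (hC : ∀ c ∈ C, c.1 < N ∧ c.2.1 < N) (hO : ∀ p ∈ O, p < N) (r : ℕ × List ℕ × ℕ) :
    BlockRDP τ N E C O r ↔ ∃ s < r.1 ^ N, (∃ p ∈ O, baseDigit r.1 s p = r.2.2) ∧
      RawRDP H τ (blockInstance l N E C r s) := by
  constructor
  · rintro ⟨y, h0, h1, h2, h3⟩
    choose z hz hzy using fun h => exists_baseDigit_eq (y h) (h0 h)
    have key : ∃ s < r.1 ^ N, (∃ p ∈ O, baseDigit r.1 s p = r.2.2) ∧ {h | z h = s}.Infinite := by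
      by_contra! hcon
      refine h3 (((Set.finite_lt_nat (r.1 ^ N)).biUnion
        (t := fun s => {h | z h = s ∧ ∃ p ∈ O, baseDigit r.1 s p = r.2.2}) fun s hs => ?_).subset ?_)
      · by_cases hp : ∃ p ∈ O, baseDigit r.1 s p = r.2.2
        · exact (hcon s hs hp).subset fun h hh => hh.1
        · simp [hp]
      · rintro h ⟨p, hp, hy⟩
        exact Set.mem_biUnion (hz h) ⟨rfl, p, hp, by rw [hzy h p (hO p hp), hy]⟩
    obtain ⟨s, hs, hp, hinf⟩ := key
    refine ⟨s, hs, hp, z, hz, fun h i => ?_, hinf⟩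
    rw [pair_notMem_blockInstance_iff (hz _) (hz _)]
    refine ⟨fun c hc hi => ?_, fun c hc => ?_⟩
    · rw [hzy _ _ (hE c hc).1, hzy _ _ (hE c hc).2, h1 h i c hc hi]
    · rw [hzy _ _ (hC c hc).1, hzy _ _ (hC c hc).2]
      exact h2 h c hc
  · rintro ⟨s, hs, ⟨p, hp, hps⟩, z, h0, h1, h2⟩
    have h0 : ∀ h, z h < r.1 ^ N := h0
    simp only [pair_notMem_blockInstance_iff (h0 _) (h0 _)] at h1
    refine ⟨fun h p => baseDigit r.1 (z h) p, fun h p hp => baseDigit_lt (h0 h) hp,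
      fun h i c hc hi => (h1 h i).1 c hc hi, fun h c hc => (h1 h ⟨0, hl⟩).2 c hc,
      h2.mono fun h hh => ⟨p, hp, ?_⟩⟩
    change baseDigit r.1 (z h) p = r.2.2
    rw [show z h = s from hh, hps]

theorem computablePred_blockRDP {H : Type*} [Group H] {l : ℕ} (hl : 0 < l) (τ : Fin l → H)
    (hτ : ComputablePred (RawRDP H τ)) {N : ℕ}
    {E C : List (ℕ × ℕ × ℕ)} {O : List ℕ} (hE : ∀ c ∈ E, c.1 < N ∧ c.2.1 < N)
    (hC : ∀ c ∈ C, c.1 < N ∧ c.2.1 < N) (hO : ∀ p ∈ O, p < N) :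
    ComputablePred (BlockRDP τ N E C O) := by
  obtain ⟨f, hf, hfe⟩ := ComputablePred.computable_iff.1 hτ
  have hO' : PrimrecPred fun x : (ℕ × List ℕ × ℕ) × ℕ =>
      ∃ p ∈ O, baseDigit x.1.1 x.2 p = x.1.2.2 := by
    have h : PrimrecRel fun (p : ℕ) (x : (ℕ × List ℕ × ℕ) × ℕ) =>
        baseDigit x.1.1 x.2 p = x.1.2.2 :=
      Primrec.eq.comp (Primrec.baseDigit (Primrec.fst.comp (Primrec.fst.comp Primrec.snd))
        (Primrec.snd.comp Primrec.snd) Primrec.fst)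
        (Primrec.snd.comp (Primrec.snd.comp (Primrec.fst.comp Primrec.snd)))
    exact h.exists_mem_list.comp (Primrec.const O) Primrec.id
  refine (ComputablePred.exists_lt (B := fun r : ℕ × List ℕ × ℕ => r.1 ^ N) ?_
    (primrec_pow.comp Primrec.fst (Primrec.const N)).to_comp).of_eq
    fun r => (blockRDP_iff hl τ hE hC hO r).symm
  obtain ⟨_, hO'⟩ := hO'
  refine ComputablePred.computable_iff.2 ⟨fun x => decide (∃ p ∈ O, baseDigit x.1.1 x.2 p = x.1.2.2)
      && f (blockInstance l N E C x.1 x.2),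
    Primrec.and.to_comp.comp hO'.to_comp (hf.comp (primrec_blockInstance l N E C).to_comp), ?_⟩
  ext x
  simp [hfe]

theorem exists_list_mem_iff {α β : Type*} [Finite α] (P : α → Prop) (f : α → β) :
    ∃ L : List β, ∀ b, b ∈ L ↔ ∃ a, P a ∧ f a = b :=
  ⟨((Set.toFinite {a | P a}).image f).toFinset.toList, fun b => by simp⟩

/-- Finitely many equalities between neighbouring blocks suffice to express that the coordinate
`u` of the block at `h` agrees with the coordinate `1` of the block at `h * u`, for `u ∈ U`. -/
theorem exists_finset_forall_eq_mul {H : Type*} [Group H] {l : ℕ} {τ : Fin l → H}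
    (hτ : Subgroup.closure (Set.range τ) = ⊤) (U : Finset H) :
    ∃ S : Finset H, 1 ∈ S ∧ U ⊆ S ∧ ∀ z : H → H → ℕ,
      (∀ h i, ∀ s ∈ S, ∀ s' ∈ S, s = τ i * s' → z h s = z (h * τ i) s') →
        ∀ u ∈ U, ∀ h, z h u = z (h * u) 1 := by
  classical
  have key : ∀ u : H, ∃ S : Finset H, 1 ∈ S ∧ u ∈ S ∧ ∀ z : H → H → ℕ,
      (∀ h i, ∀ s ∈ S, ∀ s' ∈ S, s = τ i * s' → z h s = z (h * τ i) s') →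
        ∀ h, z h u = z (h * u) 1 := by
    intro u
    have hu : u ∈ Subgroup.closure (Set.range τ) := hτ ▸ Subgroup.mem_top u
    induction hu using Subgroup.closure_induction_left with
    | one => exact ⟨{1}, by simp, by simp, fun z _ h => by rw [mul_one]⟩
    | mul_left a ha u _ ih =>
      obtain ⟨i, rfl⟩ := ha
      obtain ⟨S, h1, h2, h3⟩ := ih
      refine ⟨insert (τ i * u) S, Finset.mem_insert_of_mem h1, Finset.mem_insert_self _ _,
        fun z hz h => ?_⟩
      rw [hz h i _ (Finset.mem_insert_self _ _) u (Finset.mem_insert_of_mem h2) rfl,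
        h3 z (fun h i s hs s' hs' => hz h i s (Finset.mem_insert_of_mem hs) s'
          (Finset.mem_insert_of_mem hs')), mul_assoc]
    | inv_mul_cancel a ha u _ ih =>
      obtain ⟨i, rfl⟩ := ha
      obtain ⟨S, h1, h2, h3⟩ := ih
      refine ⟨insert ((τ i)⁻¹ * u) S, Finset.mem_insert_of_mem h1, Finset.mem_insert_self _ _,
        fun z hz h => ?_⟩
      have := hz (h * (τ i)⁻¹) i u (Finset.mem_insert_of_mem h2) _ (Finset.mem_insert_self _ _)
        (mul_inv_cancel_left _ _).symm
      rw [inv_mul_cancel_right] at this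
      rw [← this, h3 z (fun h i s hs s' hs' => hz h i s (Finset.mem_insert_of_mem hs) s'
          (Finset.mem_insert_of_mem hs')), mul_assoc]
  choose S h1 h2 h3 using key
  refine ⟨insert 1 (U.biUnion S), Finset.mem_insert_self _ _,
    fun u hu => Finset.mem_insert_of_mem (Finset.mem_biUnion.2 ⟨u, hu, h2 u⟩), fun z hz u hu => ?_⟩
  have hsub : ∀ s ∈ S u, s ∈ insert 1 (U.biUnion S) := fun s hs =>
    Finset.mem_insert_of_mem (Finset.mem_biUnion.2 ⟨u, hu, hs⟩)
  exact h3 u z fun h i s hs t ht => hz h i s (hsub s hs) t (hsub t ht)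

/-- Configurations on a group that is a finite union of copies of `H` correspond to block
configurations on `H`. -/
theorem exists_rawRDP_iff_blockRDP {G H T : Type*} [Group G] [Group H] [Finite T] {k l : ℕ}
    (σ : Fin k → G) {τ : Fin l → H} (hτ : Subgroup.closure (Set.range τ) = ⊤)
    (φ : H → G) (e : H × T ≃ G) (he : ∀ h h' t, e (h * h', t) = φ h * e (h', t)) :
    ∃ (N : ℕ) (E C : List (ℕ × ℕ × ℕ)) (O : List ℕ), (∀ c ∈ E, c.1 < N ∧ c.2.1 < N) ∧
      (∀ c ∈ C, c.1 < N ∧ c.2.1 < N) ∧ (∀ p ∈ O, p < N) ∧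
      ∀ r, RawRDP G σ r ↔ BlockRDP τ N E C O r := by
  classical
  let w : T → Fin k → H × T := fun t i => e.symm (e (1, t) * σ i)
  have hw : ∀ h t i, e (h, t) * σ i = e (h * (w t i).1, (w t i).2) := fun h t i => by
    rw [he, Prod.mk.eta, Equiv.apply_symm_apply, ← mul_assoc, ← he, mul_one]
  obtain ⟨S, h1, hUS, hS⟩ := exists_finset_forall_eq_mul hτ
    (Set.finite_range fun p : T × Fin k => (w p.1 p.2).1).toFinset
  have hwS : ∀ t i, (w t i).1 ∈ S := fun t i => hUS (by simp)
  let ν : S × T ≃ Fin (Nat.card (S × T)) := Finite.equivFin _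
  obtain ⟨E, hE⟩ := exists_list_mem_iff (fun a : S × S × T × Fin l => (a.1 : H) = τ a.2.2.2 * a.2.1)
    fun a => ((ν (a.1, a.2.2.1) : ℕ), (ν (a.2.1, a.2.2.1) : ℕ), (a.2.2.2 : ℕ))
  obtain ⟨C, hC⟩ := exists_list_mem_iff (fun _ : T × Fin k => True) fun a =>
    ((ν (⟨1, h1⟩, a.1) : ℕ), (ν (⟨(w a.1 a.2).1, hwS _ _⟩, (w a.1 a.2).2) : ℕ), (a.2 : ℕ))
  obtain ⟨O, hO⟩ := exists_list_mem_iff (fun _ : T => True) fun t => (ν (⟨1, h1⟩, t) : ℕ)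
  refine ⟨Nat.card (S × T), E, C, O, fun c hc => ?_, fun c hc => ?_, fun p hp => ?_, fun r => ?_⟩
  · obtain ⟨a, -, rfl⟩ := (hE c).1 hc
    exact ⟨(ν _).2, (ν _).2⟩
  · obtain ⟨a, -, rfl⟩ := (hC c).1 hc
    exact ⟨(ν _).2, (ν _).2⟩
  · obtain ⟨a, -, rfl⟩ := (hO p).1 hp
    exact (ν _).2
  constructor
  · rintro ⟨x, hx0, hx1, hx2⟩
    let y : H → ℕ → ℕ := fun h p => if hp : p < Nat.card (S × T) then
      x (e (h * (ν.symm ⟨p, hp⟩).1, (ν.symm ⟨p, hp⟩).2)) else 0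
    have hy : ∀ h s t, y h (ν (s, t)) = x (e (h * s, t)) := fun h s t => by
      simp only [y, dif_pos (ν (s, t)).2, Fin.eta, Equiv.symm_apply_apply]
    refine ⟨y, fun h p hp => ?_, fun h i c hc hi => ?_, fun h c hc => ?_, ?_⟩
    · simp only [y, dif_pos hp]
      exact hx0 _
    · obtain ⟨⟨s, s', t, j⟩, hs, rfl⟩ := (hE c).1 hc
      obtain rfl : j = i := Fin.ext hi
      simp only at hs
      rw [hy, hy, hs, mul_assoc]
    · obtain ⟨⟨t, i⟩, -, rfl⟩ := (hC c).1 hc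
      rw [hy, hy, mul_one, ← hw]
      exact hx1 _ _
    · intro hfin
      refine hx2 (((hfin.prod Set.finite_univ).image e).subset fun g hg => ?_)
      refine ⟨e.symm g, ⟨⟨_, (hO _).2 ⟨(e.symm g).2, trivial, rfl⟩, ?_⟩, trivial⟩,
        e.apply_symm_apply g⟩
      rw [hy, mul_one, Prod.mk.eta, Equiv.apply_symm_apply]
      exact hg
  · rintro ⟨y, hy0, hy1, hy2, hy3⟩
    have hyw : ∀ t i h, y h (ν (⟨(w t i).1, hwS t i⟩, (w t i).2)) =
        y (h * (w t i).1) (ν (⟨1, h1⟩, (w t i).2)) := fun t i h => by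
      have := hS (fun h s => if hs : s ∈ S then y h (ν (⟨s, hs⟩, (w t i).2)) else 0)
        (fun h j s hs s' hs' hss => by
          simp only [dif_pos hs, dif_pos hs']
          exact hy1 h j _ ((hE _).2 ⟨(⟨s, hs⟩, ⟨s', hs'⟩, (w t i).2, j), hss, rfl⟩) rfl)
        (w t i).1 (by simp) h
      simpa only [dif_pos (hwS t i), dif_pos h1] using this
    let x : G → ℕ := fun g => y (e.symm g).1 (ν (⟨1, h1⟩, (e.symm g).2))
    have hx : ∀ h t, x (e (h, t)) = y h (ν (⟨1, h1⟩, t)) := fun h t => by simp [x]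
    refine ⟨x, fun g => hy0 _ _ (ν _).2, fun g i => ?_, fun hfin => ?_⟩
    · obtain ⟨⟨h, t⟩, rfl⟩ := e.surjective g
      rw [hw, hx, hx, ← hyw]
      exact hy2 h _ ((hC _).2 ⟨(t, i), trivial, rfl⟩)
    · refine hy3 ((hfin.image fun g => (e.symm g).1).subset ?_)
      rintro h ⟨p, hp, hh⟩
      obtain ⟨t, -, rfl⟩ := (hO p).1 hp
      exact ⟨e (h, t), (hx h t).trans hh, by simp⟩

theorem computablePred_rawRDP_of_equiv_prod {G H T : Type*} [Group G] [Group H] [Finite T]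
    {k l : ℕ} (σ : Fin k → G) {τ : Fin l → H} (hτ : Subgroup.closure (Set.range τ) = ⊤)
    (φ : H → G) (e : H × T ≃ G) (he : ∀ h h' t, e (h * h', t) = φ h * e (h', t))
    (h : ComputablePred (RawRDP H τ)) : ComputablePred (RawRDP G σ) := by
  rcases l.eq_zero_or_pos with rfl | hl
  · rw [Set.range_eq_empty, Subgroup.closure_empty] at hτ
    have : Subsingleton H := Subgroup.subsingleton_iff.1 (subsingleton_of_bot_eq_top hτ)
    have : Finite G := Finite.of_equiv _ e
    refine ComputablePred.computable_iff.2 ⟨fun _ => false, Computable.const false, ?_⟩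
    ext r
    simp only [Bool.false_eq_true, iff_false]
    rintro ⟨x, -, -, hx⟩
    exact hx (Set.toFinite _)
  · obtain ⟨N, E, C, O, hE, hC, hO, hiff⟩ := exists_rawRDP_iff_blockRDP σ hτ φ e he
    exact (computablePred_blockRDP hl τ h hE hC hO).of_eq fun r => (hiff r).symm

theorem rawRDP_coe_iff {G : Type*} [Group G] (H : Subgroup G) [H.FiniteIndex] {l : ℕ}
    (τ : Fin l → H) (r : ℕ × List ℕ × ℕ) :
    RawRDP G (fun i => (τ i : G)) r ↔ RawRDP H τ r := by
  constructor
  · rintro ⟨x, h0, h1, h2⟩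
    have key : ∃ q : G ⧸ H, {h : H | x (q.out * h) = r.2.2}.Infinite := by
      by_contra! hcon
      refine h2 ((Set.finite_iUnion (f := fun q : G ⧸ H =>
        Set.image (fun h : H => q.out * (h : G)) {h : H | x (q.out * h) = r.2.2})
        fun q => (hcon q).image _).subset fun g hg => ?_)
      have hmem : (g : G ⧸ H).out⁻¹ * g ∈ H := QuotientGroup.eq.1 (Quotient.out_eq' _)
      refine Set.mem_iUnion.2 ⟨g, ⟨_, hmem⟩, ?_, mul_inv_cancel_left _ _⟩
      simpa using hg
    obtain ⟨q, hq⟩ := key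
    refine ⟨fun h => x (q.out * h), fun h => h0 _, fun h i => ?_, hq⟩
    have := h1 (q.out * h) i
    rwa [mul_assoc] at this
  · rintro ⟨x, h0, h1, h2⟩
    have hmem : ∀ g : G, (g : G ⧸ H).out⁻¹ * g ∈ H := fun g =>
      QuotientGroup.eq.1 (Quotient.out_eq' _)
    refine ⟨fun g => x ⟨_, hmem g⟩, fun g => h0 _, fun g i => ?_, ?_⟩
    · have hq : ((g * τ i : G) : G ⧸ H) = g := (QuotientGroup.mk_mul_of_mem g (τ i).2)
      convert h1 ⟨_, hmem g⟩ i using 5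
      ext
      simp [hq, mul_assoc]
    · refine (h2.image (f := fun h : H => ((1 : G) : G ⧸ H).out * (h : G))
        fun a _ b _ hab => Subtype.ext (mul_left_cancel hab)).mono ?_
      rintro _ ⟨h, hh, rfl⟩
      have hq : ((((1 : G) : G ⧸ H).out * (h : G) : G) : G ⧸ H) = ((1 : G) : G ⧸ H) := by
        rw [QuotientGroup.mk_mul_of_mem _ h.2]
        exact Quotient.out_eq' _
      change x _ = _
      rw [← show x h = r.2.2 from hh]
      congr 1
      ext
      simp [hq]

theorem Subgroup.exists_equiv_prod {G : Type*} [Group G] (H : Subgroup G) [H.FiniteIndex] :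
    ∃ (T : Set G) (_ : Finite T) (e : H × T ≃ G), ∀ h h' t, e (h * h', t) = h * e (h', t) := by
  obtain ⟨T, hT, -⟩ := H.exists_isComplement_right 1
  exact ⟨T, hT.finite_right, Equiv.ofBijective _ hT, fun h h' t => mul_assoc _ _ _⟩

/-- The recurring domino problem on a group is decidable iff it is decidable on
a finite-index subgroup. -/
theorem rdp_computablePred_iff_finiteIndex {G : Type*} [Group G]
    (H : Subgroup G) (hind : H.index ≠ 0) {k l : ℕ}
    (σ : Fin k → G) (τ : Fin l → H)
    (hσ : Subgroup.closure (Set.range σ) = ⊤)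
    (hτ : Subgroup.closure (Set.range τ) = ⊤) :
    ComputablePred (RDP G σ) ↔ ComputablePred (RDP H τ) := by
  have : H.FiniteIndex := ⟨hind⟩
  rw [computablePred_rdp_iff_raw, computablePred_rdp_iff_raw]
  constructor
  · intro h
    exact (computablePred_rawRDP_of_equiv_prod (fun i => (τ i : G)) hσ id (Equiv.prodPUnit.{0} G)
      (fun _ _ _ => rfl) h).of_eq (rawRDP_coe_iff H τ)
  · intro h
    obtain ⟨T, _, e, he⟩ := H.exists_equiv_prod
    exact computablePred_rawRDP_of_equiv_prod σ hτ _ e he h
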